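/- The two-sided ideals of R satisfy the ascending chain condition: every ascending chain of two-sided ideals of R stabilizes. -/

import Mathlib

/-!
`R = k⟨x,y⟩/⟨yx − 1⟩` is the associative `k`-algebra generated by `x` and `y`
with the single defining relation `y * x = 1` (the one-sided inverse of `k[x]`).
We realize it as the `RingQuot` of the free algebra on two generators.
-/

noncomputable section

/-- The defining relation `y * x = 1` on the free algebra `k⟨x,y⟩`. -/
inductive PreRel (k : Type) [Field k] : FreeAlgebra k (Fin 2) → FreeAlgebra k (Fin 2) → Prop
  | yx : PreRel k (FreeAlgebra.ι k 1 * FreeAlgebra.ι k 0) 1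

/-- `R = k⟨x,y⟩/⟨yx − 1⟩`. -/
abbrev R (k : Type) [Field k] := RingQuot (PreRel k)

/-- The generator `x` of `R`. -/
def Xg (k : Type) [Field k] : R k := RingQuot.mkAlgHom k (PreRel k) (FreeAlgebra.ι k 0)

/-- The generator `y` of `R`. -/
def Yg (k : Type) [Field k] : R k := RingQuot.mkAlgHom k (PreRel k) (FreeAlgebra.ι k 1)

lemma yx (k : Type) [Field k] : Yg k * Xg k = 1 := by
  have := RingQuot.mkAlgHom_rel k (PreRel.yx (k := k))
  simpa [Xg, Yg] using this

/-- The idempotent `e = 1 - x y`. -/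
def Eg (k : Type) [Field k] : R k := 1 - Xg k * Yg k

lemma yE (k : Type) [Field k] : Yg k * Eg k = 0 := by
  rw [Eg, mul_sub, ← mul_assoc, yx]; simp

lemma Ex (k : Type) [Field k] : Eg k * Xg k = 0 := by
  rw [Eg, sub_mul, mul_assoc, yx]; simp

lemma EE (k : Type) [Field k] : Eg k * Eg k = Eg k := by
  conv_lhs => enter [1]; rw [Eg]
  rw [sub_mul, mul_assoc, yE]; simp

lemma ypow_xpow (k : Type) [Field k] (n : ℕ) : Yg k ^ n * Xg k ^ n = 1 := by
  induction n with
  | zero => simp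
  | succ n ih =>
    rw [pow_succ, pow_succ', mul_assoc, ← mul_assoc (Yg k) (Xg k), yx, one_mul, ih]

lemma ypow_xpow_le (k : Type) [Field k] (n m : ℕ) : Yg k ^ (n + m) * Xg k ^ n = Yg k ^ m := by
  rw [add_comm, pow_add, mul_assoc, ypow_xpow, mul_one]

lemma ypow_xpow_ge (k : Type) [Field k] (n m : ℕ) : Yg k ^ n * Xg k ^ (n + m) = Xg k ^ m := by
  rw [pow_add, ← mul_assoc, ypow_xpow, one_mul]

lemma ypowE (k : Type) [Field k] (n : ℕ) : Yg k ^ (n + 1) * Eg k = 0 := by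
  rw [pow_succ, mul_assoc, yE, mul_zero]

lemma Expow (k : Type) [Field k] (n : ℕ) : Eg k * Xg k ^ (n + 1) = 0 := by
  rw [pow_succ', ← mul_assoc, Ex, zero_mul]

lemma EyxE (k : Type) [Field k] (i j : ℕ) :
    Eg k * Yg k ^ i * Xg k ^ j * Eg k = if i = j then Eg k else 0 := by
  rcases lt_trichotomy i j with h | h | h
  · obtain ⟨m, rfl⟩ := Nat.exists_eq_add_of_lt h
    rw [if_neg (by omega), mul_assoc (Eg k), add_assoc, ypow_xpow_ge, Expow, zero_mul]
  · subst h
    rw [if_pos rfl, mul_assoc (Eg k), ypow_xpow, mul_one, EE]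
  · obtain ⟨m, rfl⟩ := Nat.exists_eq_add_of_lt h
    rw [if_neg (by omega), mul_assoc (Eg k), add_assoc, ypow_xpow_le, mul_assoc, ypowE, mul_zero]

/-- The spanning family. -/
def mono (k : Type) [Field k] (p : ℕ × ℕ) : R k := Xg k ^ p.1 * Yg k ^ p.2

lemma mul_span (k : Type) [Field k] (z : R k)
    (hz : ∀ p, z * mono k p ∈ Submodule.span k (Set.range (mono k))) (s : R k)
    (hs : s ∈ Submodule.span k (Set.range (mono k))) :
    z * s ∈ Submodule.span k (Set.range (mono k)) := by
  induction hs using Submodule.span_induction with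
  | mem s h => obtain ⟨p, rfl⟩ := h; exact hz p
  | zero => simp
  | add a b _ _ ha hb => rw [mul_add]; exact add_mem ha hb
  | smul c a _ ha => rw [mul_smul_comm]; exact Submodule.smul_mem _ _ ha

lemma mono_mem (k : Type) [Field k] (i j : ℕ) :
    Xg k ^ i * Yg k ^ j ∈ Submodule.span k (Set.range (mono k)) :=
  Submodule.subset_span ⟨(i, j), rfl⟩

lemma mem_span_all (k : Type) [Field k] (a : R k) :
    a ∈ Submodule.span k (Set.range (mono k)) := by
  have key : ∀ f : FreeAlgebra k (Fin 2), ∀ s ∈ Submodule.span k (Set.range (mono k)),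
      RingQuot.mkAlgHom k (PreRel k) f * s ∈ Submodule.span k (Set.range (mono k)) := by
    intro f
    induction f using FreeAlgebra.induction with
    | grade0 r =>
      intro s hs
      rw [AlgHom.commutes, ← Algebra.smul_def]
      exact Submodule.smul_mem _ _ hs
    | grade1 t =>
      intro s hs
      refine mul_span k _ ?_ s hs
      rintro ⟨i, j⟩
      fin_cases t
      · change Xg k * (Xg k ^ i * Yg k ^ j) ∈ _
        rw [← mul_assoc, ← pow_succ']
        exact mono_mem k _ _
      · change Yg k * (Xg k ^ i * Yg k ^ j) ∈ _
        cases i with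
        | zero =>
          rw [pow_zero, one_mul, ← pow_succ']
          simpa using mono_mem k 0 (j + 1)
        | succ i =>
          rw [← mul_assoc, pow_succ', ← mul_assoc (Yg k), yx, one_mul]
          exact mono_mem k _ _
    | mul a b ha hb =>
      intro s hs
      rw [map_mul, mul_assoc]
      exact ha _ (hb _ hs)
    | add a b ha hb =>
      intro s hs
      rw [map_add, add_mul]
      exact add_mem (ha _ hs) (hb _ hs)
  obtain ⟨f, rfl⟩ := RingQuot.mkAlgHom_surjective k (PreRel k) a
  simpa using key f 1 (by simpa using mono_mem k 0 0)

lemma E_mem (k : Type) [Field k] (I : TwoSidedIdeal (R k)) (a : R k) (ha : a ∈ I)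
    (h0 : a ≠ 0) : Eg k ∈ I := by
  obtain ⟨c, rfl⟩ := (Finsupp.mem_span_range_iff_exists_finsupp).1 (mem_span_all k a)
  have hc : c.support.Nonempty := by
    rw [Finsupp.support_nonempty_iff]
    rintro rfl
    simp at h0
  obtain ⟨⟨i, j⟩, hij, hmin⟩ := Finset.exists_min_image c.support Prod.snd hc
  have hcc : c (i, j) ≠ 0 := by simpa using hij
  have h1 : Eg k * Yg k ^ i * (c.sum fun p r => r • mono k p) * (Xg k ^ j * Eg k)
      = c (i, j) • Eg k := by
    rw [Finsupp.sum, Finset.mul_sum, Finset.sum_mul, Finset.sum_eq_single (i, j)]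
    · rw [mul_smul_comm, smul_mul_assoc]
      congr 1
      have := EyxE k i i
      rw [if_pos rfl] at this
      rw [mono, ← mul_assoc, ← mul_assoc, mul_assoc _ (Yg k ^ j), ypow_xpow, mul_one, this]
    · rintro ⟨i', j'⟩ hp hne
      rw [mul_smul_comm, smul_mul_assoc]
      have hj : j ≤ j' := hmin _ hp
      obtain ⟨m, rfl⟩ := Nat.exists_eq_add_of_le hj
      rw [mono, ← mul_assoc, ← mul_assoc, mul_assoc _ (Yg k ^ (j + m)), ypow_xpow_le]
      cases m with
      | zero =>
        have hi : i ≠ i' := by rintro rfl; exact hne rfl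
        rw [pow_zero, mul_one, EyxE, if_neg hi, smul_zero]
      | succ m => rw [mul_assoc, ypowE, mul_zero, smul_zero]
    · intro h; exact absurd hij h
  have h2 : c (i, j) • Eg k ∈ I := by
    rw [← h1]
    exact I.mul_mem_right _ _ (I.mul_mem_left _ _ ha)
  have h3 := I.mul_mem_left (algebraMap k (R k) (c (i, j))⁻¹) _ h2
  rwa [← Algebra.smul_def, smul_smul, inv_mul_cancel₀ hcc, one_smul] at h3

lemma exists_poly (k : Type) [Field k] (a : R k) :
    ∃ (n : ℕ) (q : Polynomial k), a * Xg k ^ n = Polynomial.aeval (Xg k) q := by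
  induction mem_span_all k a using Submodule.span_induction with
  | mem s h =>
    obtain ⟨⟨i, j⟩, rfl⟩ := h
    refine ⟨j, Polynomial.X ^ i, ?_⟩
    rw [mono, mul_assoc, ypow_xpow]
    simp
  | zero => exact ⟨0, 0, by simp⟩
  | add a b _ _ ha hb =>
    obtain ⟨n, q, hq⟩ := ha
    obtain ⟨m, p, hp⟩ := hb
    refine ⟨n + m, q * Polynomial.X ^ m + p * Polynomial.X ^ n, ?_⟩
    rw [add_mul, pow_add, ← mul_assoc, hq, (Commute.pow_pow_self (Xg k) n m).eq, ← mul_assoc, hp]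
    simp
  | smul c a _ ha =>
    obtain ⟨n, q, hq⟩ := ha
    exact ⟨n, c • q, by rw [smul_mul_assoc, hq, map_smul]⟩

lemma sub_pow_mem (k : Type) [Field k] (I : TwoSidedIdeal (R k)) (h : Eg k ∈ I) (n : ℕ) :
    1 - Xg k ^ n * Yg k ^ n ∈ I := by
  induction n with
  | zero => simp
  | succ n ih =>
    have h1 := I.add_mem ih (I.mul_mem_right _ (Yg k ^ n) (I.mul_mem_left (Xg k ^ n) _ h))
    convert h1 using 1
    rw [Eg, pow_succ, pow_succ']
    simp only [mul_sub, sub_mul, mul_one, mul_assoc]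
    abel

/-- the two-sided ideals of `R` satisfy the ascending chain condition:
every ascending chain of two-sided ideals stabilizes. -/
theorem twoSidedIdeals_acc (k : Type) [Field k] (c : ℕ →o TwoSidedIdeal (R k)) :
    ∃ n : ℕ, ∀ m : ℕ, n ≤ m → c m = c n := by
  by_cases hE : ∃ N, Eg k ∈ c N
  · obtain ⟨N, hN⟩ := hE
    let J : ℕ →o Ideal (Polynomial k) :=
      ⟨fun n => (c n).asIdeal.comap (Polynomial.aeval (R := k) (Xg k)),
        fun a b hab => Ideal.comap_mono (TwoSidedIdeal.asIdeal.monotone (c.monotone hab))⟩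
    obtain ⟨M, hM⟩ := monotone_stabilizes_iff_noetherian.2 (inferInstance :
      IsNoetherian (Polynomial k) (Polynomial k)) J
    refine ⟨max N M, fun m hm => le_antisymm ?_ (c.monotone hm)⟩
    intro a ha
    have hEn : Eg k ∈ c (max N M) := c.monotone (le_max_left N M) hN
    obtain ⟨n, q, hq⟩ := exists_poly k a
    have hqm : q ∈ J m := by
      change Polynomial.aeval (Xg k) q ∈ c m
      rw [← hq]
      exact (c m).mul_mem_right _ _ ha
    rw [← hM m (le_trans (le_max_right _ _) hm), hM _ (le_max_right N M)] at hqm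
    have hqn : Polynomial.aeval (Xg k) q ∈ c (max N M) := hqm
    rw [← hq] at hqn
    have h1 := (c (max N M)).add_mem ((c (max N M)).mul_mem_right _ (Yg k ^ n) hqn)
      ((c (max N M)).mul_mem_left a _ (sub_pow_mem k _ hEn n))
    convert h1 using 1
    simp only [mul_sub, sub_mul, mul_one, mul_assoc]
    abel
  · push Not at hE
    have hz : ∀ n, ∀ a ∈ c n, a = 0 := by
      intro n a ha
      by_contra h
      exact hE n (E_mem k _ a ha h)
    refine ⟨0, fun m hm => le_antisymm ?_ (c.monotone hm)⟩
    intro a ha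
    rw [hz m a ha]
    exact (c 0).zero_mem
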